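/- For n ≥ 4 and 3 ≤ r ≤ n−1, a subsemigroup S of ORD(n,r) is maximal if and only if S is one of: (i) ORD(n,r) \ {α} for some α ∈ C; (ii) ORD(n,r) \ {λ_{m,r̂}} for some n−r̂+2 ≤ m ≤ n−1; (iii) ORD(n,r) \ L_{m,r̂} for some 3 ≤ m ≤ n−r̂+1. -/

import Mathlib

open Finset

namespace ORDPaper

/-- `f` is a full transformation of the chain `{1,…,n}`, acting as the identity outside. -/
def IsTrans (n : ℕ) (f : ℕ → ℕ) : Prop :=
  (∀ x, 1 ≤ x → x ≤ n → 1 ≤ f x ∧ f x ≤ n) ∧ ∀ x, ¬(1 ≤ x ∧ x ≤ n) → f x = x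

/-- Composition of transformations, written left to right: `x(αβ) = (xα)β`. -/
def comp (f g : ℕ → ℕ) : ℕ → ℕ := fun x => g (f x)

/-- The value of `f` at the cyclic successor of `i` (so `(n+1)α = 1α`). -/
def nxt (n : ℕ) (f : ℕ → ℕ) (i : ℕ) : ℕ := if i = n then f 1 else f (i + 1)

/-- `(1α,…,nα)` is cyclic: there is at most one descent (cyclically). -/
def Cyclic (n : ℕ) (f : ℕ → ℕ) : Prop :=
  ((Finset.Icc 1 n).filter (fun i => nxt n f i < f i)).card ≤ 1

/-- `(1α,…,nα)` is anti-cyclic: there is at most one ascent (cyclically). -/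
def AntiCyclic (n : ℕ) (f : ℕ → ℕ) : Prop :=
  ((Finset.Icc 1 n).filter (fun i => f i < nxt n f i)).card ≤ 1

/-- Order-decreasing on `{1,…,n}`. -/
def Decreasing (n : ℕ) (f : ℕ → ℕ) : Prop := ∀ x, 1 ≤ x → x ≤ n → f x ≤ x

/-- Image of `{1,…,n}` under `f`. -/
def im (n : ℕ) (f : ℕ → ℕ) : Finset ℕ := (Finset.Icc 1 n).image f

/-- Fixed points of `f` in `{1,…,n}`. -/
def fixSet (n : ℕ) (f : ℕ → ℕ) : Finset ℕ := (Finset.Icc 1 n).filter (fun x => f x = x)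

/-- The semigroup `D_n` of order-decreasing full transformations. -/
def Dn (n : ℕ) : Set (ℕ → ℕ) := {f | IsTrans n f ∧ Decreasing n f}

/-- Orientation-preserving order-decreasing transformations. -/
def OPD (n : ℕ) : Set (ℕ → ℕ) := {f | f ∈ Dn n ∧ Cyclic n f}

/-- Oriented order-decreasing transformations. -/
def ORDn (n : ℕ) : Set (ℕ → ℕ) := {f | f ∈ Dn n ∧ (Cyclic n f ∨ AntiCyclic n f)}

/-- `RD*_n`: orientation-reversing, order-decreasing, not orientation-preserving. -/
def RDstar (n : ℕ) : Set (ℕ → ℕ) := {f | f ∈ Dn n ∧ AntiCyclic n f ∧ ¬ Cyclic n f}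

/-- `ORD(n,r)`. -/
def ORDr (n r : ℕ) : Set (ℕ → ℕ) := {f | f ∈ ORDn n ∧ (im n f).card ≤ r}

/-- `OPD(n,r)`. -/
def OPDr (n r : ℕ) : Set (ℕ → ℕ) := {f | f ∈ OPD n ∧ (im n f).card ≤ r}

/-- The order-reversing degree: `min(X_n \ 1α⁻¹)`. -/
noncomputable def ordDeg (n : ℕ) (f : ℕ → ℕ) : ℕ := sInf {x | 1 ≤ x ∧ x ≤ n ∧ f x ≠ 1}

/-- Minimum of the preimage of `x` under `f` inside `{1,…,n}`. -/
noncomputable def preMin (n : ℕ) (f : ℕ → ℕ) (x : ℕ) : ℕ := sInf {y | 1 ≤ y ∧ y ≤ n ∧ f y = x}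

/-- Membership in the subsemigroup generated by `A`. -/
inductive gen (A : Set (ℕ → ℕ)) : (ℕ → ℕ) → Prop
  | base {f} : f ∈ A → gen A f
  | mul {f g} : gen A f → gen A g → gen A (comp f g)

/-- Rank of a transformation semigroup `S`. -/
noncomputable def rank (S : Set (ℕ → ℕ)) : ℕ :=
  sInf {k | ∃ A : Set (ℕ → ℕ), A ⊆ S ∧ A.Finite ∧ A.ncard = k ∧ {f | gen A f} = S}

/-- `r̂ = min{r, ⌈(n+1)/2⌉}`. -/
def rhat (n r : ℕ) : ℕ := min r ((n + 2) / 2)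

/-- `ρ_m` fixes `1,…,m` and sends `m+1,…,n` to `1`. -/
def rho (n m : ℕ) : ℕ → ℕ := fun x =>
  if ¬(1 ≤ x ∧ x ≤ n) then x else if x ≤ m then x else 1

/-- The order-preserving degree `opd(α) = max{m : α|_{X_m} is order-preserving}`. -/
noncomputable def opd (n : ℕ) (f : ℕ → ℕ) : ℕ :=
  sSup {m | m ≤ n ∧ ∀ x y, 1 ≤ x → x ≤ y → y ≤ m → f x ≤ f y}

/-- The set `C = (⋃_{m=r+1}^n B_m) ∪ {ρ_2,…,ρ_r}`. -/
def Cset (n r : ℕ) : Set (ℕ → ℕ) :=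
  {f | (f ∈ OPD n ∧ comp f f = f ∧ (im n f).card = r ∧ r + 1 ≤ opd n f ∧ opd n f ≤ n)
    ∨ (∃ m, 2 ≤ m ∧ m ≤ r ∧ f = rho n m)}

/-- The map `λ_{m,r}`: sends `[1,m-1]` to `1`, maps `x ∈ [m, min(2m-p-2,n)]` to `2m-x`
(where `p = max{0, m-r}` is `m - r` in truncated subtraction), and the rest of `[1,n]` to `1`. -/
def lam (n r m : ℕ) : ℕ → ℕ := fun x =>
  if ¬(1 ≤ x ∧ x ≤ n) then x
  else if x < m then 1
  else if x ≤ min (2 * m - (m - r) - 2) n then 2 * m - x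
  else 1

/-- `G_{n,r} = {λ_{m,r} : 3 ≤ m ≤ n-1}`. -/
def Gset (n r : ℕ) : Set (ℕ → ℕ) := {f | ∃ m, 3 ≤ m ∧ m ≤ n - 1 ∧ f = lam n r m}

/-- `L_{m,r}`. -/
def Lset (n r m : ℕ) : Set (ℕ → ℕ) :=
  {f | f ∈ ORDn n ∧ im n f = im n (lam n r m) ∧
    ∀ x ∈ im n (lam n r m), preMin n f x = preMin n (lam n r m) x}

/-- `α_{m,r}`: the idempotent fixing `{1} ∪ [m, 2m-p-2]` and sending the rest of `[1,n]` to `1`. -/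
def alphaMap (n r m : ℕ) : ℕ → ℕ := fun x =>
  if ¬(1 ≤ x ∧ x ≤ n) then x
  else if x < m then 1
  else if x ≤ 2 * m - (m - r) - 2 then x
  else 1

/-- `β_{m,r}`: sends `[1,m-1]` to `1`, maps `m,…,2m-p-3` order-reversingly to `m,…,p+3`,
and `[2m-p-2, n]` to `p+2`. -/
def betaMap (n r m : ℕ) : ℕ → ℕ := fun x =>
  if ¬(1 ≤ x ∧ x ≤ n) then x
  else if x < m then 1
  else if x ≤ 2 * m - (m - r) - 3 then 2 * m - x
  else (m - r) + 2

/-- `S` is a subsemigroup of `T`. -/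
def IsSubsemigroupOf (S T : Set (ℕ → ℕ)) : Prop :=
  S ⊆ T ∧ ∀ f ∈ S, ∀ g ∈ S, comp f g ∈ S

/-- `S` is a maximal subsemigroup of `T`. -/
def IsMaximalSubsemigroupOf (S T : Set (ℕ → ℕ)) : Prop :=
  IsSubsemigroupOf S T ∧ S ≠ T ∧ ∀ U, IsSubsemigroupOf U T → S ⊆ U → U = S ∨ U = T




def Pres (n : ℕ) (f : ℕ → ℕ) : Prop :=
  ∀ x y, 1 ≤ x → x ≤ y → y ≤ n → f x ≤ f y ∨ ∀ z, y ≤ z → z ≤ n → f z = 1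

def Rev (n : ℕ) (f : ℕ → ℕ) : Prop :=
  ∀ x y, 1 ≤ x → x ≤ y → y ≤ n → f y ≤ f x ∨ ∀ z, 1 ≤ z → z ≤ x → f z = 1

lemma exists_desc (f : ℕ → ℕ) (x y : ℕ) (hxy : x ≤ y) (h : f y < f x) :
    ∃ i, x ≤ i ∧ i < y ∧ f (i + 1) < f i := by
  induction y, hxy using Nat.le_induction with
  | base => omega
  | succ k hk ih =>
    by_cases h1 : f k < f x
    · obtain ⟨i, a, b, c⟩ := ih h1
      exact ⟨i, a, by omega, c⟩
    · exact ⟨k, hk, by omega, by omega⟩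

lemma exists_asc (f : ℕ → ℕ) (x y : ℕ) (hxy : x ≤ y) (h : f x < f y) :
    ∃ i, x ≤ i ∧ i < y ∧ f i < f (i + 1) := by
  induction y, hxy using Nat.le_induction with
  | base => omega
  | succ k hk ih =>
    by_cases h1 : f x < f k
    · obtain ⟨i, a, b, c⟩ := ih h1
      exact ⟨i, a, by omega, c⟩
    · exact ⟨k, hk, by omega, by omega⟩

lemma dn_one {n : ℕ} {f : ℕ → ℕ} (hn : 1 ≤ n) (hf : f ∈ Dn n) : f 1 = 1 := by
  have h1 := hf.1.1 1 le_rfl hn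
  have h2 := hf.2 1 le_rfl hn
  omega

lemma cyclic_iff {n : ℕ} {f : ℕ → ℕ} (hn : 1 ≤ n) (hf : f ∈ Dn n) :
    Cyclic n f ↔ Pres n f := by
  have h1 := dn_one hn hf
  have hpos := hf.1.1
  unfold Cyclic
  rw [Finset.card_le_one]
  simp only [Finset.mem_filter, Finset.mem_Icc]
  simp only [nxt]
  constructor
  · intro H x y hx hxy hy
    by_contra hcon
    push Not at hcon
    obtain ⟨hlt, z, hz, hzn, hz1⟩ := hcon
    obtain ⟨i, hi1, hi2, hi3⟩ := exists_desc f x y hxy hlt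
    have hi := H i ⟨⟨by omega, by omega⟩, by rw [if_neg (by omega)]; exact hi3⟩
    by_cases hzz : f n < f z
    · obtain ⟨j, hj1, hj2, hj3⟩ := exists_desc f z n hzn hzz
      have := hi j ⟨⟨by omega, by omega⟩, by rw [if_neg (by omega)]; exact hj3⟩
      omega
    · have hzp := hpos z (by omega) hzn
      have := hi n ⟨⟨by omega, by omega⟩, by rw [if_pos rfl]; omega⟩
      omega
  · intro H
    have key : ∀ i j, 1 ≤ i → i < j → j ≤ n → f (i+1) < f i →
        (if j = n then f 1 else f (j+1)) < f j → False := by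
      intro i j hi hij hj hd hd2
      have := H i (i+1) hi (by omega) (by omega)
      rcases this with h | h
      · omega
      · have e := h j (by omega) hj
        split_ifs at hd2 with hh
        · omega
        · have := hpos (j+1) (by omega) (by omega)
          omega
    rintro i ⟨⟨hi1, hi2⟩, hi3⟩ j ⟨⟨hj1, hj2⟩, hj3⟩
    rcases lt_trichotomy i j with h | h | h
    · exfalso
      rw [if_neg (by omega)] at hi3
      exact key i j hi1 h hj2 hi3 hj3
    · exact h
    · exfalso
      rw [if_neg (by omega)] at hj3
      exact key j i hj1 h hi2 hj3 hi3

lemma anti_iff {n : ℕ} {f : ℕ → ℕ} (hn : 1 ≤ n) (hf : f ∈ Dn n) :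
    AntiCyclic n f ↔ Rev n f := by
  have h1 := dn_one hn hf
  have hpos := hf.1.1
  unfold AntiCyclic
  rw [Finset.card_le_one]
  simp only [Finset.mem_filter, Finset.mem_Icc]
  simp only [nxt]
  constructor
  · intro H x y hx hxy hy
    by_contra hcon
    push Not at hcon
    obtain ⟨hlt, z, hz, hzn, hz1⟩ := hcon
    obtain ⟨i, hi1, hi2, hi3⟩ := exists_asc f x y hxy hlt
    have hi := H i ⟨⟨by omega, by omega⟩, by rw [if_neg (by omega)]; exact hi3⟩
    have hzp := hpos z (by omega) (by omega)
    obtain ⟨j, hj1, hj2, hj3⟩ := exists_asc f 1 z hz (by omega)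
    have := hi j ⟨⟨by omega, by omega⟩, by rw [if_neg (by omega)]; exact hj3⟩
    omega
  · intro H
    have key : ∀ i j, 1 ≤ i → i < j → j ≤ n → f i < f (i+1) →
        f j < (if j = n then f 1 else f (j+1)) → False := by
      intro i j hi hij hj hd hd2
      split_ifs at hd2 with hh
      · have := hpos j (by omega) hj
        omega
      · rcases H j (j+1) (by omega) (by omega) (by omega) with h | h
        · omega
        · have e1 := h i hi (by omega)
          have e2 := h (i+1) (by omega) (by omega)
          omega
    rintro i ⟨⟨hi1, hi2⟩, hi3⟩ j ⟨⟨hj1, hj2⟩, hj3⟩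
    rcases lt_trichotomy i j with h | h | h
    · exfalso
      rw [if_neg (by omega)] at hi3
      exact key i j hi1 h hj2 hi3 hj3
    · exact h
    · exfalso
      rw [if_neg (by omega)] at hj3
      exact key j i hj1 h hi2 hj3 hi3

lemma comp_dn {n : ℕ} {f g : ℕ → ℕ} (hf : f ∈ Dn n) (hg : g ∈ Dn n) : comp f g ∈ Dn n := by
  refine ⟨⟨fun x h1 h2 => ?_, fun x h => ?_⟩, fun x h1 h2 => ?_⟩
  · have a := hf.1.1 x h1 h2
    exact hg.1.1 _ a.1 a.2
  · show g (f x) = x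
    rw [hf.1.2 x h, hg.1.2 x h]
  · have a := hf.1.1 x h1 h2
    have b := hf.2 x h1 h2
    have c := hg.2 _ a.1 a.2
    exact c.trans b

lemma pres_pres {n : ℕ} {f g : ℕ → ℕ} (hn : 1 ≤ n) (hf : f ∈ Dn n) (hg : g ∈ Dn n)
    (h1 : Pres n f) (h2 : Pres n g) : Pres n (comp f g) := by
  intro x y hx hxy hy
  have g1 := dn_one hn hg
  have px := hf.1.1 x hx (by omega)
  have py := hf.1.1 y (by omega) (by omega)
  simp only [comp]
  rcases h1 x y hx hxy hy with h | h
  · rcases h2 _ _ px.1 h py.2 with h' | h'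
    · exact Or.inl h'
    · right
      intro z hz hzn
      have pz := hf.1.1 z (by omega) (by omega)
      rcases h1 y z (by omega) hz hzn with h3 | h3
      · exact h' _ h3 pz.2
      · rw [h3 z le_rfl hzn, g1]
  · right
    intro z hz hzn
    rw [h z hz hzn, g1]

lemma pres_rev {n : ℕ} {f g : ℕ → ℕ} (hn : 1 ≤ n) (hf : f ∈ Dn n) (hg : g ∈ Dn n)
    (h1 : Pres n f) (h2 : Rev n g) : Rev n (comp f g) := by
  intro x y hx hxy hy
  have g1 := dn_one hn hg
  have px := hf.1.1 x hx (by omega)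
  have py := hf.1.1 y (by omega) (by omega)
  have pg := hg.1.1 _ px.1 px.2
  simp only [comp]
  rcases h1 x y hx hxy hy with h | h
  · rcases h2 _ _ px.1 h py.2 with h' | h'
    · exact Or.inl h'
    · by_cases hh : ∀ z, 1 ≤ z → z ≤ x → f z ≤ f x
      · right
        intro z hz hzn
        exact h' _ (hf.1.1 z hz (by omega)).1 (hh z hz hzn)
      · push Not at hh
        obtain ⟨z, z1, z2, z3⟩ := hh
        left
        rcases h1 z x z1 z2 (by omega) with h3 | h3
        · omega
        · rw [h3 y hxy hy, g1]; omega
  · left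
    rw [h y le_rfl hy, g1]; omega

lemma rev_pres {n : ℕ} {f g : ℕ → ℕ} (hn : 1 ≤ n) (hf : f ∈ Dn n) (hg : g ∈ Dn n)
    (h1 : Rev n f) (h2 : Pres n g) : Rev n (comp f g) := by
  intro x y hx hxy hy
  have g1 := dn_one hn hg
  have px := hf.1.1 x hx (by omega)
  have py := hf.1.1 y (by omega) (by omega)
  simp only [comp]
  rcases h1 x y hx hxy hy with h | h
  · rcases h2 _ _ py.1 h px.2 with h' | h'
    · exact Or.inl h'
    · right
      intro z hz hzn
      have pz := hf.1.1 z (by omega) (by omega)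
      rcases h1 z x (by omega) hzn (by omega) with h3 | h3
      · exact h' _ h3 pz.2
      · rw [h3 z hz le_rfl, g1]
  · right
    intro z hz hzn
    rw [h z hz hzn, g1]

lemma rev_rev {n : ℕ} {f g : ℕ → ℕ} (hn : 1 ≤ n) (hf : f ∈ Dn n) (hg : g ∈ Dn n)
    (h1 : Rev n f) (h2 : Rev n g) : Pres n (comp f g) := by
  intro x y hx hxy hy
  have g1 := dn_one hn hg
  have px := hf.1.1 x hx (by omega)
  have py := hf.1.1 y (by omega) (by omega)
  have pgx := hg.1.1 _ px.1 px.2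
  have pgy := hg.1.1 _ py.1 py.2
  simp only [comp]
  rcases h1 x y hx hxy hy with h | h
  · rcases h2 _ _ py.1 h px.2 with h' | h'
    · exact Or.inl h'
    · by_cases hh : ∀ z, y ≤ z → z ≤ n → f z ≤ f y
      · right
        intro z hz hzn
        exact h' _ (hf.1.1 z (by omega) (by omega)).1 (hh z hz hzn)
      · push Not at hh
        obtain ⟨z, z1, z2, z3⟩ := hh
        left
        rcases h1 y z (by omega) z1 (by omega) with h3 | h3
        · omega
        · rw [h3 x hx hxy, g1]; omega
  · left
    rw [h x hx le_rfl, g1]; omega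

lemma mem_ORDr {n r : ℕ} (hn : 1 ≤ n) {f : ℕ → ℕ} :
    f ∈ ORDr n r ↔ f ∈ Dn n ∧ (Pres n f ∨ Rev n f) ∧ (im n f).card ≤ r := by
  constructor
  · rintro ⟨⟨h1, h2⟩, h3⟩
    rw [cyclic_iff hn h1, anti_iff hn h1] at h2
    exact ⟨h1, h2, h3⟩
  · rintro ⟨h1, h2, h3⟩
    refine ⟨⟨h1, ?_⟩, h3⟩
    rw [cyclic_iff hn h1, anti_iff hn h1]
    exact h2

lemma im_comp (n : ℕ) (f g : ℕ → ℕ) : im n (comp f g) = (im n f).image g := by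
  unfold im
  rw [Finset.image_image]
  rfl

lemma comp_ORDr {n r : ℕ} (hn : 1 ≤ n) {f g : ℕ → ℕ} (hf : f ∈ ORDr n r) (hg : g ∈ ORDr n r) :
    comp f g ∈ ORDr n r := by
  rw [mem_ORDr hn] at *
  obtain ⟨f1, f2, f3⟩ := hf
  obtain ⟨g1, g2, g3⟩ := hg
  refine ⟨comp_dn f1 g1, ?_, ?_⟩
  · rcases f2 with f2 | f2 <;> rcases g2 with g2 | g2
    · exact Or.inl (pres_pres hn f1 g1 f2 g2)
    · exact Or.inr (pres_rev hn f1 g1 f2 g2)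
    · exact Or.inr (rev_pres hn f1 g1 f2 g2)
    · exact Or.inl (rev_rev hn f1 g1 f2 g2)
  · rw [im_comp]
    exact Finset.card_image_le.trans f3

lemma mem_im {n : ℕ} {f : ℕ → ℕ} {v : ℕ} : v ∈ im n f ↔ ∃ x, 1 ≤ x ∧ x ≤ n ∧ f x = v := by
  simp [im, and_assoc]

/-- The idempotent with image `A` and degree `t`. -/
def E (n : ℕ) (A : Finset ℕ) (t : ℕ) : ℕ → ℕ := fun x =>
  if 1 ≤ x ∧ x ≤ n then (if x ≤ t then (A.filter (fun a => a ≤ x)).sup id else 1) else x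

def fl (A : Finset ℕ) (x : ℕ) : ℕ := (A.filter (fun a => a ≤ x)).sup id

lemma fl_le (A : Finset ℕ) (x : ℕ) : fl A x ≤ x := by
  unfold fl
  apply Finset.sup_le
  intro b hb
  exact (Finset.mem_filter.1 hb).2

lemma le_fl {A : Finset ℕ} {x a : ℕ} (ha : a ∈ A) (h : a ≤ x) : a ≤ fl A x := by
  unfold fl
  exact Finset.le_sup (f := id) (Finset.mem_filter.2 ⟨ha, h⟩)

lemma fl_mem {A : Finset ℕ} {x : ℕ} (h1 : 1 ∈ A) (h : 1 ≤ x) : fl A x ∈ A := by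
  unfold fl
  obtain ⟨b, hb, hb2⟩ := Finset.exists_mem_eq_sup (A.filter (fun a => a ≤ x))
    ⟨1, Finset.mem_filter.2 ⟨h1, h⟩⟩ id
  rw [hb2]
  exact (Finset.mem_filter.1 hb).1

lemma fl_eq {A : Finset ℕ} {x : ℕ} (hx : x ∈ A) : fl A x = x :=
  le_antisymm (fl_le A x) (le_fl hx le_rfl)

lemma fl_mono (A : Finset ℕ) {x y : ℕ} (h1 : 1 ∈ A) (hx : 1 ≤ x) (h : x ≤ y) :
    fl A x ≤ fl A y :=
  le_fl (fl_mem h1 hx) ((fl_le A x).trans h)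

lemma fl_unique {A : Finset ℕ} {x v : ℕ} (h1 : 1 ∈ A) (hx : 1 ≤ x) (hv : v ∈ A) (hvx : v ≤ x)
    (h : ∀ a ∈ A, a ≤ x → a ≤ v) : fl A x = v :=
  le_antisymm (h _ (fl_mem h1 hx) (fl_le A x)) (le_fl hv hvx)

lemma E_in {n : ℕ} {A : Finset ℕ} {t x : ℕ} (h1 : 1 ≤ x) (h2 : x ≤ n) (h3 : x ≤ t) :
    E n A t x = fl A x := by
  simp [E, fl, h1, h2, h3]

lemma E_tail {n : ℕ} {A : Finset ℕ} {t x : ℕ} (h1 : 1 ≤ x) (h2 : x ≤ n) (h3 : t < x) :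
    E n A t x = 1 := by
  simp [E, h1, h2, h3]

lemma E_out {n : ℕ} {A : Finset ℕ} {t x : ℕ} (h : ¬ (1 ≤ x ∧ x ≤ n)) : E n A t x = x := by
  simp only [E, if_neg h]

lemma E_dn {n : ℕ} {A : Finset ℕ} {t : ℕ} (h1 : 1 ∈ A) : E n A t ∈ Dn n := by
  have key : ∀ x, 1 ≤ x → x ≤ n → 1 ≤ E n A t x ∧ E n A t x ≤ x := by
    intro x hx hxn
    by_cases h : x ≤ t
    · rw [E_in hx hxn h]
      exact ⟨le_fl h1 hx, fl_le A x⟩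
    · rw [E_tail hx hxn (by omega)]
      omega
  refine ⟨⟨fun x hx hxn => ?_, fun x h => E_out h⟩, fun x hx hxn => (key x hx hxn).2⟩
  have := key x hx hxn
  omega

lemma E_pres {n : ℕ} {A : Finset ℕ} {t : ℕ} (h1 : 1 ∈ A) : Pres n (E n A t) := by
  intro x y hx hxy hy
  by_cases h : y ≤ t
  · left
    rw [E_in hx (by omega) (by omega), E_in (by omega) hy h]
    exact fl_mono A h1 hx hxy
  · right
    intro z hz hzn
    exact E_tail (by omega) hzn (by omega)

lemma E_fix {n : ℕ} {A : Finset ℕ} {t x : ℕ} (hA : A ⊆ Finset.Icc 1 t) (ht : t ≤ n) (hx : x ∈ A) :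
    E n A t x = x := by
  have := Finset.mem_Icc.1 (hA hx)
  rw [E_in this.1 (by omega) this.2, fl_eq hx]

lemma E_mem {n : ℕ} {A : Finset ℕ} {t x : ℕ} (h1 : 1 ∈ A) (hx : 1 ≤ x) (hxn : x ≤ n) :
    E n A t x ∈ A := by
  by_cases h : x ≤ t
  · rw [E_in hx hxn h]; exact fl_mem h1 hx
  · rw [E_tail hx hxn (by omega)]; exact h1

lemma E_im {n : ℕ} {A : Finset ℕ} {t : ℕ} (h1 : 1 ∈ A) (hA : A ⊆ Finset.Icc 1 t) (ht : t ≤ n) :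
    im n (E n A t) = A := by
  ext v
  rw [mem_im]
  constructor
  · rintro ⟨x, hx, hxn, rfl⟩
    exact E_mem h1 hx hxn
  · intro hv
    have := Finset.mem_Icc.1 (hA hv)
    exact ⟨v, this.1, by omega, E_fix hA ht hv⟩

lemma E_full {n t : ℕ} (ht : t ≤ n) : E n (Finset.Icc 1 t) t = rho n t := by
  funext x
  by_cases h : 1 ≤ x ∧ x ≤ n
  · by_cases h2 : x ≤ t
    · rw [E_fix subset_rfl ht (Finset.mem_Icc.2 ⟨h.1, h2⟩)]
      simp [rho, h2]
    · rw [E_tail h.1 h.2 (by omega)]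
      simp [rho, h, h2]
  · rw [E_out h]
    simp only [rho, if_pos h]

lemma E_C {n r : ℕ} {A : Finset ℕ} {t : ℕ} (hr : 3 ≤ r) (h1 : 1 ∈ A) (hA : A ⊆ Finset.Icc 1 t)
    (ht : t ≤ n) (hc : A.card = r) : E n A t ∈ Cset n r := by
  have hle := Finset.card_le_card hA
  rw [Nat.card_Icc] at hle
  by_cases htr : t = r
  · right
    refine ⟨r, by omega, le_rfl, ?_⟩
    have : A = Finset.Icc 1 t := Finset.eq_of_subset_of_card_le hA (by rw [Nat.card_Icc]; omega)
    rw [this, E_full ht, htr]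
  · left
    refine ⟨⟨E_dn h1, (cyclic_iff (by omega) (E_dn h1)).2 (E_pres h1)⟩, ?_, ?_, ?_, ?_⟩
    · funext x
      show E n A t (E n A t x) = E n A t x
      by_cases h : 1 ≤ x ∧ x ≤ n
      · exact E_fix hA ht (E_mem h1 h.1 h.2)
      · rw [E_out h, E_out h]
    · rw [E_im h1 hA ht, hc]
    · have : t ≤ opd n (E n A t) := by
        apply le_csSup
        · exact ⟨n, fun m hm => hm.1⟩
        · refine ⟨ht, fun x y hx hxy hy => ?_⟩
          rw [E_in hx (by omega) (by omega), E_in (by omega) (by omega) hy]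
          exact fl_mono A h1 hx hxy
      omega
    · apply csSup_le
      · exact ⟨0, by omega, fun x y hx hxy hy => by omega⟩
      · exact fun m hm => hm.1

lemma gen_E_aux {n r : ℕ} (hr : 3 ≤ r) (hrn : r + 1 ≤ n) (d : ℕ) :
    ∀ (A : Finset ℕ) (t : ℕ), 1 ∈ A → A ⊆ Finset.Icc 1 t → t ≤ n → A.card + d = r →
      gen (Cset n r) (E n A t) := by
  induction d with
  | zero =>
    intro A t h1 hA ht hc
    exact gen.base (E_C hr h1 hA ht (by omega))
  | succ d ih =>
    have big : ∀ (A : Finset ℕ) (t : ℕ), 1 ∈ A → A ⊆ Finset.Icc 1 t → t ≤ n →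
        A.card + (d + 1) = r → A.card + 2 ≤ t → gen (Cset n r) (E n A t) := by
      intro A t h1 hA ht hc htc
      have hcard : 1 < (Finset.Icc 1 t \ A).card := by
        rw [Finset.card_sdiff_of_subset hA, Nat.card_Icc]; omega
      obtain ⟨b, hb, c, hcm, hbc⟩ : ∃ b ∈ Finset.Icc 1 t \ A, ∃ c ∈ Finset.Icc 1 t \ A, b < c := by
        obtain ⟨b, hb, c, hc', hne⟩ := Finset.one_lt_card.1 hcard
        rcases lt_or_gt_of_ne hne with h | h
        · exact ⟨b, hb, c, hc', h⟩
        · exact ⟨c, hc', b, hb, h⟩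
      rw [Finset.mem_sdiff, Finset.mem_Icc] at hb hcm
      have hB : insert b A ⊆ Finset.Icc 1 t := Finset.insert_subset (Finset.mem_Icc.2 hb.1) hA
      have hC : insert c A ⊆ Finset.Icc 1 n := Finset.insert_subset
        (Finset.mem_Icc.2 ⟨hcm.1.1, by omega⟩) (hA.trans (Finset.Icc_subset_Icc_right ht))
      have hB1 : 1 ∈ insert b A := Finset.mem_insert_of_mem h1
      have hC1 : 1 ∈ insert c A := Finset.mem_insert_of_mem h1
      have e : E n A t = comp (E n (insert b A) t) (E n (insert c A) n) := by
        funext x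
        show _ = E n (insert c A) n (E n (insert b A) t x)
        by_cases h : 1 ≤ x ∧ x ≤ n
        · by_cases hxt : x ≤ t
          · rw [E_in h.1 h.2 hxt, E_in h.1 h.2 hxt]
            have p1 := fl_le (insert b A) x
            have p2 := le_fl hB1 h.1
            rw [E_in p2 (by omega) (by omega)]
            have q1 := fl_le A x
            have q2 := fl_mem h1 h.1
            rcases Finset.mem_insert.1 (fl_mem hB1 h.1) with hh | hh
            · rw [hh] at p1 p2 ⊢
              symm
              have hle : fl A x ≤ b := by
                rw [← hh]; exact le_fl (Finset.mem_insert_of_mem q2) q1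
              refine fl_unique hC1 p2 (Finset.mem_insert_of_mem q2) hle ?_
              intro a ha hab
              rcases Finset.mem_insert.1 ha with rfl | ha
              · omega
              · exact le_fl ha (by omega)
            · rw [fl_eq (Finset.mem_insert_of_mem hh)]
              apply le_antisymm
              · exact le_fl (Finset.mem_insert_of_mem q2) q1
              · exact le_fl hh p1
          · rw [E_tail h.1 h.2 (by omega), E_tail h.1 h.2 (by omega), E_fix hC le_rfl hC1]
        · rw [E_out h, E_out h, E_out h]
      rw [e]
      refine gen.mul (ih _ _ hB1 hB ht ?_) (ih _ _ hC1 hC le_rfl ?_)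
      · rw [Finset.card_insert_of_notMem hb.2]; omega
      · rw [Finset.card_insert_of_notMem hcm.2]; omega
    intro A t h1 hA ht hc
    have hle := Finset.card_le_card hA
    rw [Nat.card_Icc] at hle
    have hAn : A ⊆ Finset.Icc 1 n := hA.trans (Finset.Icc_subset_Icc_right ht)
    have hA0 : 1 ≤ A.card := Finset.card_pos.2 ⟨1, h1⟩
    rcases (by omega : A.card + 2 ≤ t ∨ t = A.card + 1 ∨ t = A.card) with h | h | h
    · exact big A t h1 hA ht hc h
    · have e : E n A t = comp (rho n t) (E n A n) := by
        rw [← E_full ht]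
        funext x
        show _ = E n A n (E n (Finset.Icc 1 t) t x)
        by_cases hx : 1 ≤ x ∧ x ≤ n
        · by_cases hxt : x ≤ t
          · rw [E_in hx.1 hx.2 hxt, E_in hx.1 hx.2 hxt, fl_eq (Finset.mem_Icc.2 ⟨hx.1, hxt⟩),
              E_in hx.1 hx.2 hx.2]
          · rw [E_tail hx.1 hx.2 (by omega), E_tail hx.1 hx.2 (by omega), E_fix hAn le_rfl h1]
        · rw [E_out hx, E_out hx, E_out hx]
      rw [e]
      exact gen.mul (gen.base (Or.inr ⟨t, by omega, by omega, rfl⟩))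
        (big A n h1 hAn le_rfl hc (by omega))
    · have hAe : A = Finset.Icc 1 t :=
        Finset.eq_of_subset_of_card_le hA (by rw [Nat.card_Icc]; omega)
      by_cases ht2 : 2 ≤ t
      · rw [hAe, E_full ht]
        exact gen.base (Or.inr ⟨t, by omega, by omega, rfl⟩)
      · have e : E n A t = E n A n := by
          funext x
          by_cases hx : 1 ≤ x ∧ x ≤ n
          · by_cases hxt : x ≤ t
            · rw [E_in hx.1 hx.2 hxt, E_in hx.1 hx.2 hx.2]
            · rw [E_tail hx.1 hx.2 (by omega), E_in hx.1 hx.2 hx.2]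
              symm
              refine fl_unique h1 hx.1 h1 hx.1 ?_
              intro a ha _
              have := Finset.mem_Icc.1 (hA ha)
              omega
          · rw [E_out hx, E_out hx]
        rw [e]
        exact big A n h1 hAn le_rfl hc (by omega)

lemma gen_E {n r : ℕ} (hr : 3 ≤ r) (hrn : r + 1 ≤ n) {A : Finset ℕ} {t : ℕ} (h1 : 1 ∈ A)
    (hA : A ⊆ Finset.Icc 1 t) (ht : t ≤ n) (hc : A.card ≤ r) : gen (Cset n r) (E n A t) :=
  gen_E_aux hr hrn (r - A.card) A t h1 hA ht (by omega)

lemma gen_pres_aux {n r : ℕ} (hr : 3 ≤ r) (hrn : r + 1 ≤ n) (d : ℕ) :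
    ∀ f : ℕ → ℕ, f ∈ Dn n → Pres n f → (im n f).card ≤ r →
      (∑ x ∈ Finset.Icc 1 n, (x - f x)) ≤ d → gen (Cset n r) f := by
  have hn : 1 ≤ n := by omega
  induction d with
  | zero =>
    intro f hf hp hc hs
    exfalso
    have hid : ∀ x ∈ Finset.Icc 1 n, f x = x := by
      intro x hx
      have h := (Finset.sum_eq_zero_iff.1 (Nat.le_zero.1 hs)) x hx
      have hx' := Finset.mem_Icc.1 hx
      have := hf.2 x hx'.1 hx'.2
      omega
    have : im n f = Finset.Icc 1 n := by
      unfold im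
      rw [Finset.image_congr (g := id) (fun x hx => hid x hx), Finset.image_id]
    rw [this, Nat.card_Icc] at hc
    omega
  | succ d ih =>
    intro f hf hp hc hs
    have f1 := dn_one hn hf
    have hpos := hf.1.1
    have h1im : 1 ∈ im n f := mem_im.2 ⟨1, le_rfl, hn, f1⟩
    have himn : im n f ⊆ Finset.Icc 1 n := by
      intro v hv
      obtain ⟨x, a, b, rfl⟩ := mem_im.1 hv
      exact Finset.mem_Icc.2 (hpos x a b)
    by_cases hfix : ∀ v ∈ im n f, f v = v
    · -- idempotent
      obtain ⟨t, ht1, htn, htp, htt⟩ : ∃ t, 1 ≤ t ∧ t ≤ n ∧ (t = 1 ∨ f t ≠ 1) ∧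
          ∀ x, t < x → x ≤ n → f x = 1 := by
        classical
        let P : ℕ → Prop := fun t => 1 ≤ t ∧ (t = 1 ∨ f t ≠ 1)
        have hP1 : P 1 := ⟨le_rfl, Or.inl rfl⟩
        have hs := Nat.findGreatest_spec (P := P) hn hP1
        refine ⟨Nat.findGreatest P n, hs.1, Nat.findGreatest_le n, hs.2, ?_⟩
        intro x hx hxn
        have := Nat.findGreatest_is_greatest hx hxn
        by_contra hne
        exact this ⟨by omega, Or.inr hne⟩
      have e : f = E n (im n f) t := by
        funext x
        by_cases hx : 1 ≤ x ∧ x ≤ n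
        · by_cases hxt : x ≤ t
          · rw [E_in hx.1 hx.2 hxt]
            symm
            refine fl_unique h1im hx.1 (mem_im.2 ⟨x, hx.1, hx.2, rfl⟩) (hf.2 x hx.1 hx.2) ?_
            intro a ha hax
            have ha' := Finset.mem_Icc.1 (himn ha)
            rcases hp a x ha'.1 hax hx.2 with h | h
            · rw [hfix a ha] at h; exact h
            · have h3 := h t hxt htn
              rcases htp with h4 | h4
              · have := hpos x hx.1 hx.2
                omega
              · exact absurd h3 h4
          · rw [E_tail hx.1 hx.2 (by omega)]
            exact htt x (by omega) hx.2
        · rw [E_out hx, hf.1.2 x hx]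
      rw [e]
      refine gen_E hr hrn h1im ?_ htn hc
      intro v hv
      have hv' := Finset.mem_Icc.1 (himn hv)
      rw [Finset.mem_Icc]
      refine ⟨hv'.1, ?_⟩
      by_contra hcon
      have := htt v (by omega) hv'.2
      rw [hfix v hv] at this
      omega
    · push Not at hfix
      obtain ⟨w, hw, hwne⟩ := hfix
      obtain ⟨v, hv, hvmax⟩ := Finset.exists_max_image ((im n f).filter (fun v => f v ≠ v)) id
        ⟨w, Finset.mem_filter.2 ⟨hw, hwne⟩⟩
      rw [Finset.mem_filter] at hv
      obtain ⟨hv, hvne⟩ := hv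
      have hv1 : v ≠ 1 := by rintro rfl; exact hvne f1
      obtain ⟨x0, hx01, hx0n, hx0⟩ := mem_im.1 hv
      have hvx : ∀ x, 1 ≤ x → x ≤ n → f x = v → v + 1 ≤ x := by
        intro x a b c
        have := hf.2 x a b
        rcases Nat.lt_or_ge v x with h | h
        · exact h
        · have : x = v := by omega
          subst this
          exact absurd c hvne
      have hvp := Finset.mem_Icc.1 (himn hv)
      have hv1im : v + 1 ∉ im n f := by
        intro hmem
        have hfv : f (v+1) = v+1 := by
          by_contra hne
          have := hvmax (v+1) (Finset.mem_filter.2 ⟨hmem, hne⟩)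
          simp at this
        have := hvx x0 hx01 hx0n hx0
        rcases hp (v+1) x0 (by omega) this hx0n with h | h
        · omega
        · have := h x0 le_rfl hx0n
          omega
      let f' : ℕ → ℕ := fun x => if 1 ≤ x ∧ x ≤ n then (if f x = v then v + 1 else f x) else x
      have hf'1 : ∀ x, 1 ≤ x → x ≤ n → f x = v → f' x = v + 1 := by
        intro x a b c; simp [f', a, b, c]
      have hf'2 : ∀ x, 1 ≤ x → x ≤ n → f x ≠ v → f' x = f x := by
        intro x a b c; simp [f', a, b, c]
      have hf'3 : ∀ x, ¬ (1 ≤ x ∧ x ≤ n) → f' x = x := by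
        intro x a; simp only [f', if_neg a]
      have hdn : f' ∈ Dn n := by
        refine ⟨⟨fun x a b => ?_, hf'3⟩, fun x a b => ?_⟩
        · by_cases c : f x = v
          · rw [hf'1 x a b c]; have := hvx x a b c; omega
          · rw [hf'2 x a b c]; exact hpos x a b
        · by_cases c : f x = v
          · rw [hf'1 x a b c]; exact hvx x a b c
          · rw [hf'2 x a b c]; exact hf.2 x a b
      have hpr : Pres n f' := by
        intro x y hx hxy hy
        rcases hp x y hx hxy hy with h | h
        · left
          by_cases c : f x = v
          · rw [hf'1 x hx (by omega) c]
            by_cases c' : f y = v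
            · rw [hf'1 y (by omega) hy c']
            · rw [hf'2 y (by omega) hy c']; omega
          · rw [hf'2 x hx (by omega) c]
            by_cases c' : f y = v
            · rw [hf'1 y (by omega) hy c']; omega
            · rw [hf'2 y (by omega) hy c']; omega
        · right
          intro z hz hzn
          have := h z hz hzn
          rw [hf'2 z (by omega) hzn (by omega), this]
      have himf : (im n f').card ≤ r := by
        refine le_trans (Finset.card_le_card (t := (im n f).image
          (fun u => if u = v then v + 1 else u)) ?_) (Finset.card_image_le.trans hc)
        intro u hu
        obtain ⟨x, a, b, rfl⟩ := mem_im.1 hu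
        refine Finset.mem_image.2 ⟨f x, mem_im.2 ⟨x, a, b, rfl⟩, ?_⟩
        simp [f', a, b]
      have hsum : (∑ x ∈ Finset.Icc 1 n, (x - f' x)) < ∑ x ∈ Finset.Icc 1 n, (x - f x) := by
        apply Finset.sum_lt_sum
        · intro x hx
          have hx' := Finset.mem_Icc.1 hx
          by_cases c : f x = v
          · rw [hf'1 x hx'.1 hx'.2 c]; omega
          · rw [hf'2 x hx'.1 hx'.2 c]
        · refine ⟨x0, Finset.mem_Icc.2 ⟨hx01, hx0n⟩, ?_⟩
          rw [hf'1 x0 hx01 hx0n hx0]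
          have := hvx x0 hx01 hx0n hx0
          omega
      have e : f = comp f' (E n (im n f) n) := by
        funext x
        show f x = E n (im n f) n (f' x)
        by_cases hx : 1 ≤ x ∧ x ≤ n
        · by_cases c : f x = v
          · rw [hf'1 x hx.1 hx.2 c, c]
            have := hvx x hx.1 hx.2 c
            rw [E_in (by omega) (by omega) (by omega)]
            symm
            refine fl_unique h1im (by omega) hv (by omega) ?_
            intro a ha hav
            rcases Nat.lt_or_ge v a with h | h
            · have : a = v + 1 := by omega
              rw [this] at ha
              exact absurd ha hv1im
            · exact h
          · rw [hf'2 x hx.1 hx.2 c, E_fix himn le_rfl (mem_im.2 ⟨x, hx.1, hx.2, rfl⟩)]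
        · rw [hf'3 x hx, E_out hx, hf.1.2 x hx]
      rw [e]
      exact gen.mul (ih f' hdn hpr himf (by omega)) (gen_E hr hrn h1im himn le_rfl hc)

lemma gen_pres {n r : ℕ} (hr : 3 ≤ r) (hrn : r + 1 ≤ n) {f : ℕ → ℕ} (hf : f ∈ Dn n)
    (hp : Pres n f) (hc : (im n f).card ≤ r) : gen (Cset n r) f :=
  gen_pres_aux hr hrn _ f hf hp hc le_rfl

def sm (n r m : ℕ) : ℕ := min (min m (rhat n r) - 2) (n - m)

def Q (n r m : ℕ) (f : ℕ → ℕ) : Prop :=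
  (∀ x, 1 ≤ x → x < m → f x = 1) ∧ ∀ i, i ≤ sm n r m → f (m + i) = m - i

lemma rhat_spec (n r : ℕ) : (rhat n r = r ∨ rhat n r = (n + 2) / 2) ∧ rhat n r ≤ r ∧
    rhat n r ≤ (n + 2) / 2 := by
  unfold rhat; omega

lemma sm_spec (n r m : ℕ) : sm n r m ≤ m - 2 ∧ sm n r m ≤ rhat n r - 2 ∧ sm n r m ≤ n - m ∧
    (sm n r m = m - 2 ∨ sm n r m = rhat n r - 2 ∨ sm n r m = n - m) := by
  unfold sm; omega

/-- sm ≥ 1 in the relevant range -/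
lemma sm_pos {n r m : ℕ} (hr : 3 ≤ r) (hrn : r + 1 ≤ n) (hm : 3 ≤ m) (hmn : m + 1 ≤ n) :
    1 ≤ sm n r m := by
  have := rhat_spec n r
  unfold sm
  omega

lemma Q_rev {n r m : ℕ} {f : ℕ → ℕ} (hr : 3 ≤ r) (hrn : r + 1 ≤ n) (hm : 3 ≤ m) (hmn : m + 1 ≤ n)
    (hQ : Q n r m f) : ¬ Pres n f := by
  intro hp
  have h0 := hQ.2 0 (by omega)
  have h1 := hQ.2 1 (sm_pos hr hrn hm hmn)
  rcases hp m (m+1) (by omega) (by omega) (by omega) with h | h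
  · simp at h0; omega
  · have := h (m+1) le_rfl (by omega)
    omega

lemma Q_im {n r m : ℕ} {f : ℕ → ℕ} (hr : 3 ≤ r) (hrn : r + 1 ≤ n) (hm : 3 ≤ m) (hmn : m + 1 ≤ n)
    (hf : f ∈ ORDr n r) (hQ : Q n r m f) :
    im n f = insert 1 (Finset.Icc (m - sm n r m) m) := by
  have hn : 1 ≤ n := by omega
  have hs := sm_spec n r m
  have hrh := rhat_spec n r
  have hsp := sm_pos hr hrn hm hmn
  rw [mem_ORDr hn] at hf
  obtain ⟨hd, hpr, hc⟩ := hf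
  have hrev : Rev n f := hpr.resolve_left (Q_rev hr hrn hm hmn hQ)
  have f1 := dn_one hn hd
  have hsub : insert 1 (Finset.Icc (m - sm n r m) m) ⊆ im n f := by
    apply Finset.insert_subset
    · exact mem_im.2 ⟨1, le_rfl, hn, f1⟩
    · intro v hv
      rw [Finset.mem_Icc] at hv
      refine mem_im.2 ⟨m + (m - v), by omega, by omega, ?_⟩
      rw [hQ.2 (m - v) (by omega)]
      omega
  have hcard : (insert 1 (Finset.Icc (m - sm n r m) m)).card = sm n r m + 2 := by
    rw [Finset.card_insert_of_notMem (by rw [Finset.mem_Icc]; omega), Nat.card_Icc]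
    omega
  by_cases hcase : sm n r m + 2 = r
  · symm
    exact Finset.eq_of_subset_of_card_le hsub (by omega)
  · apply Finset.Subset.antisymm _ hsub
    intro v hv
    obtain ⟨x, hx, hxn, rfl⟩ := mem_im.1 hv
    rw [Finset.mem_insert, Finset.mem_Icc]
    by_cases h1 : x < m
    · left; exact hQ.1 x hx h1
    · by_cases h2 : x ≤ m + sm n r m
      · right
        have := hQ.2 (x - m) (by omega)
        rw [show m + (x - m) = x by omega] at this
        omega
      · have e := hQ.2 (sm n r m) le_rfl
        have em := hQ.2 0 (by omega)
        have p := hd.1.1 x hx hxn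
        rcases hrev (m + sm n r m) x (by omega) (by omega) hxn with h | h
        · omega
        · have := h m (by omega) (by omega)
          simp at em; omega

lemma preMin_eq {n : ℕ} {f : ℕ → ℕ} {v y : ℕ} (h1 : 1 ≤ y) (h2 : y ≤ n) (h3 : f y = v)
    (h : ∀ x, 1 ≤ x → x < y → f x ≠ v) : preMin n f v = y := by
  unfold preMin
  apply le_antisymm
  · exact Nat.sInf_le ⟨h1, h2, h3⟩
  · have := Nat.sInf_mem (s := {y | 1 ≤ y ∧ y ≤ n ∧ f y = v}) ⟨y, h1, h2, h3⟩
    by_contra hcon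
    exact h _ this.1 (by omega) this.2.2

lemma Q_preMin_one {n r m : ℕ} {f : ℕ → ℕ} (hm : 3 ≤ m) (hmn : m + 1 ≤ n)
    (hQ : Q n r m f) : preMin n f 1 = 1 :=
  preMin_eq le_rfl (by omega) (hQ.1 1 le_rfl (by omega)) (fun x h1 h2 => by omega)

lemma Q_preMin {n r m i : ℕ} {f : ℕ → ℕ} (hm : 3 ≤ m) (hmn : m + 1 ≤ n)
    (hQ : Q n r m f) (hi : i ≤ sm n r m) : preMin n f (m - i) = m + i := by
  have hs := sm_spec n r m
  refine preMin_eq (by omega) (by omega) (hQ.2 i hi) ?_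
  intro x h1 h2
  by_cases h : x < m
  · rw [hQ.1 x h1 h]; omega
  · have := hQ.2 (x - m) (by omega)
    rw [show m + (x - m) = x by omega] at this
    omega

lemma Q_lam {n r m : ℕ} (hr : 3 ≤ r) (hrn : r + 1 ≤ n) (hm : 3 ≤ m) (hmn : m + 1 ≤ n) :
    Q n r m (lam n (rhat n r) m) := by
  have hs := sm_spec n r m
  have hrh := rhat_spec n r
  constructor
  · intro x h1 h2
    simp only [lam]
    rw [if_neg (by omega), if_pos h2]
  · intro i hi
    simp only [lam]
    rw [if_neg (by omega), if_neg (by omega), if_pos (by omega)]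
    omega

lemma lam_mem {n r m : ℕ} (hr : 3 ≤ r) (hrn : r + 1 ≤ n) (hm : 3 ≤ m) (hmn : m + 1 ≤ n) :
    lam n (rhat n r) m ∈ ORDr n r := by
  have hrh := rhat_spec n r
  rw [mem_ORDr (by omega)]
  refine ⟨⟨⟨?_, ?_⟩, ?_⟩, Or.inr ?_, ?_⟩
  · intro x h1 h2
    simp only [lam]
    split_ifs <;> omega
  · intro x h
    simp only [lam, if_pos h]
  · intro x h1 h2
    simp only [lam]
    split_ifs <;> omega
  · intro x y hx hxy hy
    by_cases h : x < m
    · right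
      intro z hz hzx
      simp only [lam]
      split_ifs <;> omega
    · left
      simp only [lam]
      split_ifs <;> omega
  · have hsub : im n (lam n (rhat n r) m) ⊆
        insert 1 (Finset.Icc (m - (min m (rhat n r) - 2)) m) := by
      intro v hv
      obtain ⟨x, h1, h2, rfl⟩ := mem_im.1 hv
      rw [Finset.mem_insert, Finset.mem_Icc]
      simp only [lam]
      split_ifs <;> omega
    refine (Finset.card_le_card hsub).trans ((Finset.card_insert_le _ _).trans ?_)
    rw [Nat.card_Icc]
    omega

lemma mem_Lset {n r m : ℕ} {f : ℕ → ℕ} (hr : 3 ≤ r) (hrn : r + 1 ≤ n) (hm : 3 ≤ m)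
    (hmn : m + 1 ≤ n) : f ∈ Lset n (rhat n r) m ↔ f ∈ ORDr n r ∧ Q n r m f := by
  have hl := lam_mem hr hrn hm hmn
  have hQl := Q_lam hr hrn hm hmn
  have himl := Q_im hr hrn hm hmn hl hQl
  have hs := sm_spec n r m
  constructor
  · rintro ⟨h1, h2, h3⟩
    refine ⟨⟨h1, ?_⟩, ?_⟩
    · rw [h2]; exact hl.2
    · have hd := h1.1
      have key : ∀ i, i ≤ sm n r m → preMin n f (m - i) = m + i := by
        intro i hi
        rw [h3 (m - i) (by rw [himl, Finset.mem_insert, Finset.mem_Icc]; omega)]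
        exact Q_preMin hm hmn hQl hi
      constructor
      · intro x hx hxm
        by_contra hne
        have hmem : f x ∈ im n f := mem_im.2 ⟨x, hx, by omega, rfl⟩
        rw [h2, himl, Finset.mem_insert, Finset.mem_Icc] at hmem
        have hk := key (m - f x) (by omega)
        rw [show m - (m - f x) = f x by omega] at hk
        have : preMin n f (f x) ≤ x := Nat.sInf_le ⟨hx, by omega, rfl⟩
        omega
      · intro i hi
        have hmem : m - i ∈ im n f := by
          rw [h2, himl, Finset.mem_insert, Finset.mem_Icc]; omega
        obtain ⟨x, a, b, c⟩ := mem_im.1 hmem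
        have := Nat.sInf_mem (s := {y | 1 ≤ y ∧ y ≤ n ∧ f y = m - i}) ⟨x, a, b, c⟩
        have hk := key i hi
        unfold preMin at hk
        rw [hk] at this
        exact this.2.2
  · rintro ⟨hf, hQ⟩
    refine ⟨hf.1, ?_, ?_⟩
    · rw [himl, Q_im hr hrn hm hmn hf hQ]
    · intro x hx
      rw [himl, Finset.mem_insert, Finset.mem_Icc] at hx
      rcases hx with rfl | hx
      · rw [Q_preMin_one hm hmn hQ, Q_preMin_one hm hmn hQl]
      · have a := Q_preMin hm hmn hQ (i := m - x) (by omega)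
        have b := Q_preMin hm hmn hQl (i := m - x) (by omega)
        rw [show m - (m - x) = x by omega] at a b
        rw [a, b]

lemma Lset_single {n r m : ℕ} (hr : 3 ≤ r) (hrn : r + 1 ≤ n) (hm : n - rhat n r + 2 ≤ m)
    (hmn : m + 1 ≤ n) : Lset n (rhat n r) m = {lam n (rhat n r) m} := by
  have hrh := rhat_spec n r
  have hs : sm n r m = n - m := by unfold sm; omega
  have hm3 : 3 ≤ m := by omega
  have hQl := Q_lam hr hrn hm3 hmn
  have hl := lam_mem hr hrn hm3 hmn
  ext f
  rw [mem_Lset hr hrn hm3 hmn, Set.mem_singleton_iff]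
  constructor
  · rintro ⟨hf, hQ⟩
    funext x
    by_cases hx : 1 ≤ x ∧ x ≤ n
    · by_cases h : x < m
      · rw [hQ.1 x hx.1 h, hQl.1 x hx.1 h]
      · have a := hQ.2 (x - m) (by omega)
        have b := hQl.2 (x - m) (by omega)
        rw [show m + (x - m) = x by omega] at a b
        rw [a, b]
    · rw [hf.1.1.1.2 x hx, hl.1.1.1.2 x hx]
  · rintro rfl
    exact ⟨hl, hQl⟩

lemma rev_below {n m : ℕ} {g : ℕ → ℕ} (hd : g ∈ Dn n) (hg : Rev n g) (hm : 3 ≤ m) (hmn : m ≤ n)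
    (h : g m = m) : ∀ x, 1 ≤ x → x < m → g x = 1 := by
  intro x hx hxm
  rcases hg x m hx (by omega) hmn with h' | h'
  · have := hd.2 x hx (by omega)
    omega
  · exact h' x hx le_rfl

lemma irred_L {n r m : ℕ} {f g : ℕ → ℕ} (hr : 3 ≤ r) (hrn : r + 1 ≤ n) (hm : 3 ≤ m)
    (hmn : m + 1 ≤ n) (hf : f ∈ ORDr n r) (hg : g ∈ ORDr n r)
    (h : comp f g ∈ Lset n (rhat n r) m) :
    f ∈ Lset n (rhat n r) m ∨ g ∈ Lset n (rhat n r) m := by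
  have hn : 1 ≤ n := by omega
  simp only [mem_Lset hr hrn hm hmn] at h ⊢
  obtain ⟨-, hQ⟩ := h
  have hs := sm_spec n r m
  have hnp := Q_rev hr hrn hm hmn hQ
  have hf' := (mem_ORDr hn).1 hf
  have hg' := (mem_ORDr hn).1 hg
  obtain ⟨fd, fo, -⟩ := hf'
  obtain ⟨gd, go, -⟩ := hg'
  have hq : ∀ i, i ≤ sm n r m → g (f (m + i)) = m - i := hQ.2
  have g1 := dn_one hn gd
  have fm : f m = m := by
    have a := fd.1.1 m (by omega) (by omega)
    have b := fd.2 m (by omega) (by omega)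
    have c := gd.2 (f m) a.1 a.2
    have d := hq 0 (by omega)
    simp at d
    omega
  have gm : g m = m := by
    have d := hq 0 (by omega)
    simp [fm] at d
    exact d
  rcases fo with fo | fo <;> rcases go with go | go
  · exact absurd (pres_pres hn fd gd fo go) hnp
  · right
    refine ⟨hg, rev_below gd go hm (by omega) gm, ?_⟩
    have key : ∀ i, i ≤ sm n r m → f (m + i) = m + i := by
      intro i
      induction i with
      | zero => intro _; exact fm
      | succ i ih =>
        intro hi
        have e := ih (by omega)
        have q1 := hq i (by omega)
        have q2 := hq (i + 1) hi
        have d := fd.2 (m + (i + 1)) (by omega) (by omega)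
        rcases fo (m + i) (m + (i + 1)) (by omega) (by omega) (by omega) with h | h
        · by_cases heq : f (m + (i + 1)) = m + i
          · rw [heq, ← e, q1] at q2
            omega
          · omega
        · have := h (m + (i + 1)) le_rfl (by omega)
          rw [this, g1] at q2
          omega
    intro i hi
    have := hq i hi
    rwa [key i hi] at this
  · left
    refine ⟨hf, rev_below fd fo hm (by omega) fm, ?_⟩
    have key : ∀ i, i ≤ sm n r m → f (m + i) ≤ m - i := by
      intro i
      induction i with
      | zero => intro _; simp [fm]
      | succ i ih =>
        intro hi
        have e := ih (by omega)
        have q1 := hq i (by omega)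
        have q2 := hq (i + 1) hi
        rcases fo (m + i) (m + (i + 1)) (by omega) (by omega) (by omega) with h | h
        · by_cases heq : f (m + (i + 1)) = f (m + i)
          · rw [heq, q1] at q2
            omega
          · omega
        · have := h m (by omega) (by omega)
          omega
    intro i hi
    have a := key i hi
    have b := hq i hi
    have c := fd.1.1 (m + i) (by omega) (by omega)
    have d := gd.2 _ c.1 c.2
    omega
  · exact absurd (rev_rev hn fd gd fo go) hnp

lemma L_trans {n r m : ℕ} {f g : ℕ → ℕ} (hr : 3 ≤ r) (hrn : r + 1 ≤ n) (hm : 3 ≤ m)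
    (hmn : m + 1 ≤ n) (hf : f ∈ Lset n (rhat n r) m) (hg : g ∈ Lset n (rhat n r) m) :
    ∃ h, h ∈ Dn n ∧ Pres n h ∧ (im n h).card ≤ r ∧ f = comp h g := by
  have hn : 1 ≤ n := by omega
  rw [mem_Lset hr hrn hm hmn] at hf hg
  obtain ⟨hf, hQ⟩ := hf
  obtain ⟨hg, hQg⟩ := hg
  have hs := sm_spec n r m
  have hrh := rhat_spec n r
  have him := Q_im hr hrn hm hmn hf hQ
  obtain ⟨fd, fo, -⟩ := (mem_ORDr hn).1 hf
  obtain ⟨gd, go, -⟩ := (mem_ORDr hn).1 hg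
  have fo := fo.resolve_left (Q_rev hr hrn hm hmn hQ)
  have f1 := dn_one hn fd
  have g1 := dn_one hn gd
  have fm := hQ.2 0 (by omega)
  simp only [Nat.add_zero, Nat.sub_zero] at fm
  have hanti : ∀ x y, m ≤ x → x ≤ y → y ≤ n → f y ≤ f x := by
    intro x y a b c
    rcases fo x y (by omega) b c with h | h
    · exact h
    · have := h m (by omega) a
      omega
  have hbot : ∀ x, m + sm n r m ≤ x → x ≤ n → f x ≠ 1 → f x = m - sm n r m := by
    intro x a b c
    have h1 := hanti _ _ (by omega) a b
    rw [hQ.2 _ le_rfl] at h1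
    have h2 : f x ∈ im n f := mem_im.2 ⟨x, by omega, b, rfl⟩
    rw [him, Finset.mem_insert, Finset.mem_Icc] at h2
    omega
  have hne : ∀ x, 1 ≤ x → x ≤ n → f x ≠ 1 → m ≤ x := by
    intro x a b c
    by_contra hlt
    exact c (hQ.1 x a (by omega))
  let h : ℕ → ℕ := fun x => if 1 ≤ x ∧ x ≤ n then (if f x = 1 then 1 else min x (m + sm n r m)) else x
  have h_one : ∀ x, 1 ≤ x → x ≤ n → f x = 1 → h x = 1 := by
    intro x a b c; simp [h, a, b, c]
  have h_ne : ∀ x, 1 ≤ x → x ≤ n → f x ≠ 1 → h x = min x (m + sm n r m) := by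
    intro x a b c; simp [h, a, b, c]
  have h_out : ∀ x, ¬ (1 ≤ x ∧ x ≤ n) → h x = x := by
    intro x a; simp only [h, if_neg a]
  refine ⟨h, ⟨⟨?_, h_out⟩, ?_⟩, ?_, ?_, ?_⟩
  · intro x a b
    by_cases c : f x = 1
    · rw [h_one x a b c]; omega
    · rw [h_ne x a b c]; omega
  · intro x a b
    by_cases c : f x = 1
    · rw [h_one x a b c]; omega
    · rw [h_ne x a b c]; omega
  · intro x y hx hxy hy
    by_cases c : f x = 1
    · left
      rw [h_one x hx (by omega) c]
      by_cases c' : f y = 1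
      · rw [h_one y (by omega) hy c']
      · rw [h_ne y (by omega) hy c']; omega
    · have hmx := hne x hx (by omega) c
      by_cases c' : f y = 1
      · right
        intro z hz hzn
        have a1 := hanti y z (by omega) hz hzn
        have a2 := fd.1.1 z (by omega) hzn
        exact h_one z (by omega) hzn (by omega)
      · left
        rw [h_ne x hx (by omega) c, h_ne y (by omega) hy c']
        omega
  · have hsub : im n h ⊆ insert 1 (Finset.Icc m (m + sm n r m)) := by
      intro v hv
      obtain ⟨x, a, b, rfl⟩ := mem_im.1 hv
      rw [Finset.mem_insert, Finset.mem_Icc]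
      by_cases c : f x = 1
      · left; exact h_one x a b c
      · right
        rw [h_ne x a b c]
        have := hne x a b c
        omega
    refine (Finset.card_le_card hsub).trans ((Finset.card_insert_le _ _).trans ?_)
    rw [Nat.card_Icc]
    omega
  · funext x
    show f x = g (h x)
    by_cases hx : 1 ≤ x ∧ x ≤ n
    · by_cases c : f x = 1
      · rw [h_one x hx.1 hx.2 c, g1, c]
      · rw [h_ne x hx.1 hx.2 c]
        have hmx := hne x hx.1 hx.2 c
        by_cases hle : x ≤ m + sm n r m
        · rw [min_eq_left hle]
          have a := hQ.2 (x - m) (by omega)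
          have b := hQg.2 (x - m) (by omega)
          rw [show m + (x - m) = x by omega] at a b
          rw [a, b]
        · rw [min_eq_right (by omega), hQg.2 _ le_rfl]
          exact hbot x (by omega) hx.2 c
    · rw [h_out x hx, fd.1.2 x hx, gd.1.2 x hx]

lemma rev_factor {n r : ℕ} {f : ℕ → ℕ} (hr : 3 ≤ r) (hrn : r + 1 ≤ n) (fd : f ∈ Dn n)
    (fo : Rev n f) (hnp : ¬ Pres n f) (hc : (im n f).card ≤ r) :
    ∃ m h g, 3 ≤ m ∧ m + 1 ≤ n ∧ (h ∈ Dn n ∧ Pres n h ∧ (im n h).card ≤ r) ∧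
      (g ∈ Dn n ∧ Pres n g ∧ (im n g).card ≤ r) ∧
      f = comp h (comp (lam n (rhat n r) m) g) := by
  classical
  have hn : 1 ≤ n := by omega
  have f1 := dn_one hn fd
  have hpos := fd.1.1
  have h1im : 1 ∈ im n f := mem_im.2 ⟨1, le_rfl, hn, f1⟩
  unfold Pres at hnp
  push Not at hnp
  obtain ⟨x, y, hx, hxy, hy, hlt, z, hyz, hzn, hz⟩ := hnp
  have hex : ∃ m, 1 ≤ m ∧ m ≤ n ∧ f m ≠ 1 := ⟨z, by omega, hzn, hz⟩
  obtain ⟨m, ⟨hm1, hmn, hfm⟩, hmin⟩ : ∃ m, (1 ≤ m ∧ m ≤ n ∧ f m ≠ 1) ∧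
      ∀ x, 1 ≤ x → x < m → f x = 1 := by
    refine ⟨Nat.find hex, Nat.find_spec hex, ?_⟩
    intro x hx hxm
    have a := Nat.find_min hex hxm
    have b := (Nat.find_spec hex).2.1
    by_contra hne
    exact a ⟨hx, by omega, hne⟩
  have hanti : ∀ x y, m ≤ x → x ≤ y → y ≤ n → f y ≤ f x := by
    intro x y a b c
    rcases fo x y (by omega) b c with h | h
    · exact h
    · exact absurd (h m hm1 a) hfm
  have hne : ∀ x, 1 ≤ x → x ≤ n → f x ≠ 1 → m ≤ x := by
    intro x a b c
    by_contra hlt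
    exact c (hmin x a (by omega))
  have pz := hpos z (by omega) hzn
  have py := hpos y (by omega) hy
  have hmx : m ≤ x := hne x hx (by omega) (by omega)
  have a1 := hanti m x le_rfl hmx (by omega)
  have a2 := hanti y z (by omega) hyz hzn
  have a3 := fd.2 m hm1 hmn
  have hm3 : 3 ≤ m := by omega
  have hmn' : m + 1 ≤ n := by
    by_contra hcon
    have : x = y := by omega
    subst this
    omega
  have hle_m : ∀ v ∈ im n f, v ≤ m := by
    intro v hv
    obtain ⟨w, b, c, rfl⟩ := mem_im.1 hv
    by_cases hw : w < m
    · rw [hmin w b hw]; omega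
    · have := hanti m w le_rfl (by omega) c
      omega
  have hge1 : ∀ v ∈ im n f, 1 ≤ v := by
    intro v hv
    obtain ⟨w, b, c, rfl⟩ := mem_im.1 hv
    exact (hpos w b c).1
  let c : ℕ → ℕ := fun v => ((im n f).filter (fun u => v < u)).card
  have c_anti : ∀ v w, v ≤ w → c w ≤ c v := by
    intro v w hvw
    apply Finset.card_le_card
    intro u hu
    rw [Finset.mem_filter] at hu ⊢
    exact ⟨hu.1, by omega⟩
  have c_strict : ∀ v w, w ∈ im n f → v < w → c w < c v := by
    intro v w hw hvw
    apply Finset.card_lt_card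
    rw [Finset.ssubset_iff_of_subset]
    · exact ⟨w, Finset.mem_filter.2 ⟨hw, hvw⟩, by simp⟩
    · intro u hu
      rw [Finset.mem_filter] at hu ⊢
      exact ⟨hu.1, by omega⟩
  have c_m : ∀ v ∈ im n f, v + c v ≤ m := by
    intro v hv
    have : c v ≤ (Finset.Ioc v m).card := by
      apply Finset.card_le_card
      intro u hu
      rw [Finset.mem_filter] at hu
      exact Finset.mem_Ioc.2 ⟨hu.2, hle_m u hu.1⟩
    rw [Nat.card_Ioc] at this
    have := hle_m v hv
    omega
  have c_x : ∀ w, 1 ≤ w → w ≤ n → f w ≠ 1 → m + c (f w) ≤ w := by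
    intro w hw hwn hfw
    have hmw := hne w hw hwn hfw
    have : c (f w) ≤ (Finset.Ico m w).card := by
      refine le_trans (Finset.card_le_card (t := (Finset.Ico m w).image f) ?_)
        Finset.card_image_le
      intro u hu
      rw [Finset.mem_filter] at hu
      obtain ⟨t, t1, t2, rfl⟩ := mem_im.1 hu.1
      have p := hpos w hw hwn
      have hmt := hne t t1 t2 (by omega)
      refine Finset.mem_image.2 ⟨t, Finset.mem_Ico.2 ⟨hmt, ?_⟩, rfl⟩
      by_contra hcon
      have := hanti w t hmw (by omega) t2
      omega
    rw [Nat.card_Ico] at this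
    omega
  have c_r : ∀ v ∈ im n f, v ≠ 1 → c v + 2 ≤ r := by
    intro v hv hv1
    have hvp := hge1 v hv
    have e : (insert 1 (insert v ((im n f).filter (fun u => v < u)))).card = c v + 2 := by
      rw [Finset.card_insert_of_notMem, Finset.card_insert_of_notMem]
      · simp
      · rw [Finset.mem_insert, Finset.mem_filter]
        omega
    have : (insert 1 (insert v ((im n f).filter (fun u => v < u)))).card ≤ (im n f).card :=
      Finset.card_le_card (Finset.insert_subset h1im (Finset.insert_subset hv
        (Finset.filter_subset _ _)))
    omega
  have hrh := rhat_spec n r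
  have c_s : ∀ w, 1 ≤ w → w ≤ n → f w ≠ 1 → c (f w) ≤ sm n r m := by
    intro w hw hwn hfw
    have hmem : f w ∈ im n f := mem_im.2 ⟨w, hw, hwn, rfl⟩
    have b1 := c_x w hw hwn hfw
    have b2 := c_r _ hmem hfw
    have b3 := c_m _ hmem
    have b4 := hge1 _ hmem
    unfold sm
    omega
  let h : ℕ → ℕ := fun x => if 1 ≤ x ∧ x ≤ n then (if f x = 1 then 1 else m + c (f x)) else x
  have h_one : ∀ x, 1 ≤ x → x ≤ n → f x = 1 → h x = 1 := by
    intro x a b c'; simp [h, a, b, c']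
  have h_ne : ∀ x, 1 ≤ x → x ≤ n → f x ≠ 1 → h x = m + c (f x) := by
    intro x a b c'; simp [h, a, b, c']
  have h_out : ∀ x, ¬ (1 ≤ x ∧ x ≤ n) → h x = x := by
    intro x a; simp only [h, if_neg a]
  let F : ℕ → Finset ℕ := fun y => (im n f).filter (fun v => v = 1 ∨ m ≤ y + c v)
  have hF1 : ∀ y, 1 ∈ F y := fun y => Finset.mem_filter.2 ⟨h1im, Or.inl rfl⟩
  let g : ℕ → ℕ := fun y => if 1 ≤ y ∧ y ≤ n then (if y ≤ m then (F y).sup id else 1) else y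
  have g_in : ∀ y, 1 ≤ y → y ≤ m → g y = (F y).sup id := by
    intro y a b
    simp only [g]
    rw [if_pos ⟨a, by omega⟩, if_pos b]
  have g_tail : ∀ y, m < y → y ≤ n → g y = 1 := by
    intro y a b
    simp only [g]
    rw [if_pos ⟨by omega, by omega⟩, if_neg (by omega)]
  have g_out : ∀ x, ¬ (1 ≤ x ∧ x ≤ n) → g x = x := by
    intro x a; simp only [g, if_neg a]
  have hsup1 : ∀ y, 1 ≤ (F y).sup id := fun y => Finset.le_sup (f := id) (hF1 y)
  have hsup2 : ∀ y, 1 ≤ y → (F y).sup id ≤ y := by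
    intro y hy
    apply Finset.sup_le
    intro v hv
    obtain ⟨v1, v2⟩ := Finset.mem_filter.1 hv
    have := c_m v v1
    show v ≤ y
    omega
  have hsupmem : ∀ y, (F y).sup id ∈ im n f := by
    intro y
    obtain ⟨b, hb, hb2⟩ := Finset.exists_mem_eq_sup (F y) ⟨1, hF1 y⟩ id
    rw [hb2]
    exact (Finset.mem_filter.1 hb).1
  refine ⟨m, h, g, hm3, hmn', ⟨⟨⟨?_, h_out⟩, ?_⟩, ?_, ?_⟩, ⟨⟨⟨?_, g_out⟩, ?_⟩, ?_, ?_⟩, ?_⟩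
  · intro x a b
    by_cases d : f x = 1
    · rw [h_one x a b d]; omega
    · rw [h_ne x a b d]; have := c_x x a b d; omega
  · intro x a b
    by_cases d : f x = 1
    · rw [h_one x a b d]; omega
    · rw [h_ne x a b d]; have := c_x x a b d; omega
  · intro x y hx hxy hy
    by_cases d : f x = 1
    · left
      rw [h_one x hx (by omega) d]
      by_cases d' : f y = 1
      · rw [h_one y (by omega) hy d']
      · rw [h_ne y (by omega) hy d']; omega
    · have hmx := hne x hx (by omega) d
      by_cases d' : f y = 1
      · right
        intro z hz hzn
        have a1 := hanti y z (by omega) hz hzn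
        have a2 := fd.1.1 z (by omega) hzn
        exact h_one z (by omega) hzn (by omega)
      · left
        rw [h_ne x hx (by omega) d, h_ne y (by omega) hy d']
        have := c_anti _ _ (hanti x y hmx hxy hy)
        omega
  · refine le_trans (Finset.card_le_card (t := (im n f).image
      (fun u => if u = 1 then 1 else m + c u)) ?_) (Finset.card_image_le.trans hc)
    intro u hu
    obtain ⟨x, a, b, rfl⟩ := mem_im.1 hu
    refine Finset.mem_image.2 ⟨f x, mem_im.2 ⟨x, a, b, rfl⟩, ?_⟩
    simp [h, a, b]
  · intro y a b
    by_cases d : y ≤ m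
    · rw [g_in y a d]
      have := hsup1 y
      have := hsup2 y a
      omega
    · rw [g_tail y (by omega) b]; omega
  · intro y a b
    by_cases d : y ≤ m
    · rw [g_in y a d]
      exact hsup2 y a
    · rw [g_tail y (by omega) b]; omega
  · intro x y hx hxy hy
    by_cases d : y ≤ m
    · left
      rw [g_in x hx (by omega), g_in y (by omega) d]
      apply Finset.sup_mono
      intro v hv
      rw [Finset.mem_filter] at hv ⊢
      exact ⟨hv.1, by omega⟩
    · right
      intro z hz hzn
      exact g_tail z (by omega) hzn
  · refine le_trans (Finset.card_le_card ?_) hc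
    intro u hu
    obtain ⟨x, a, b, rfl⟩ := mem_im.1 hu
    by_cases d : x ≤ m
    · rw [g_in x a d]; exact hsupmem x
    · rw [g_tail x (by omega) b]; exact h1im
  · have hQ := Q_lam hr hrn hm3 hmn'
    have g1 : g 1 = 1 := by
      rw [g_in 1 le_rfl hm1]
      exact le_antisymm (hsup2 1 le_rfl) (hsup1 1)
    funext x
    show f x = g (lam n (rhat n r) m (h x))
    by_cases hx : 1 ≤ x ∧ x ≤ n
    · by_cases d : f x = 1
      · rw [h_one x hx.1 hx.2 d, hQ.1 1 le_rfl (by omega), g1, d]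
      · rw [h_ne x hx.1 hx.2 d, hQ.2 _ (c_s x hx.1 hx.2 d)]
        have hmem : f x ∈ im n f := mem_im.2 ⟨x, hx.1, hx.2, rfl⟩
        have b1 := c_m _ hmem
        have b2 := hge1 _ hmem
        rw [g_in _ (by omega) (by omega)]
        apply le_antisymm
        · exact Finset.le_sup (f := id) (Finset.mem_filter.2 ⟨hmem, Or.inr (by omega)⟩)
        · apply Finset.sup_le
          intro v hv
          obtain ⟨v1, v2⟩ := Finset.mem_filter.1 hv
          show v ≤ f x
          rcases v2 with rfl | v2
          · exact b2
          · by_contra hcon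
            have := c_strict (f x) v v1 (by omega)
            omega
    · have := (lam_mem hr hrn hm3 hmn').1.1.1.2 x hx
      rw [h_out x hx, this, g_out x hx, fd.1.2 x hx]

lemma rho_props {n m : ℕ} (hm : 1 ≤ m) (hmn : m ≤ n) :
    rho n m ∈ Dn n ∧ Pres n (rho n m) ∧ (im n (rho n m)).card = m := by
  have h1 : 1 ∈ Finset.Icc 1 m := Finset.mem_Icc.2 ⟨le_rfl, hm⟩
  rw [← E_full hmn]
  refine ⟨E_dn h1, E_pres h1, ?_⟩
  rw [E_im h1 subset_rfl hmn, Nat.card_Icc]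
  omega

lemma C_props {n r : ℕ} (hr : 3 ≤ r) (hrn : r + 1 ≤ n) {f : ℕ → ℕ} (hf : f ∈ Cset n r) :
    f ∈ Dn n ∧ Pres n f ∧ (im n f).card ≤ r := by
  rcases hf with ⟨h1, -, h3, -, -⟩ | ⟨m, h1, h2, rfl⟩
  · exact ⟨h1.1, (cyclic_iff (by omega) h1.1).1 h1.2, h3.le⟩
  · obtain ⟨a, b, c⟩ := rho_props (n := n) (m := m) (by omega) (by omega)
    exact ⟨a, b, by omega⟩

lemma rho_char {n m : ℕ} {f : ℕ → ℕ} (hf : f ∈ Dn n) (h1 : ∀ x, 1 ≤ x → x ≤ m → f x = x)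
    (h2 : ∀ x, m < x → x ≤ n → f x = 1) : f = rho n m := by
  funext x
  by_cases hx : 1 ≤ x ∧ x ≤ n
  · by_cases hm : x ≤ m
    · rw [h1 x hx.1 hm]; simp [rho, hm]
    · rw [h2 x (by omega) hx.2]; simp [rho, hx, hm]
  · rw [hf.1.2 x hx]; simp only [rho, if_pos hx]

lemma fix_of_comp {n : ℕ} {f g : ℕ → ℕ} (hf : f ∈ Dn n) (hg : g ∈ Dn n) {x : ℕ} (h1 : 1 ≤ x)
    (h2 : x ≤ n) (h : g (f x) = x) : f x = x ∧ g x = x := by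
  have a := hf.2 x h1 h2
  have b := hf.1.1 x h1 h2
  have c := hg.2 _ b.1 b.2
  have e : f x = x := by omega
  rw [e] at h
  exact ⟨e, h⟩

/-- A map fixing `1..m` (`m ≥ 2`) and sending `m+1` to `1` is `ρ_m`. -/
lemma rho_of_next {n m : ℕ} {g : ℕ → ℕ} (hm : 2 ≤ m) (hmn : m + 1 ≤ n) (hd : g ∈ Dn n)
    (ho : Pres n g ∨ Rev n g) (hfix : ∀ x, 1 ≤ x → x ≤ m → g x = x) (h : g (m + 1) = 1) :
    g = rho n m := by
  refine rho_char hd hfix ?_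
  have gm := hfix m (by omega) le_rfl
  intro x hx hxn
  have p := hd.1.1 x (by omega) hxn
  rcases ho with ho | ho
  · rcases ho m (m+1) (by omega) (by omega) hmn with h' | h'
    · omega
    · exact h' x (by omega) hxn
  · rcases ho (m+1) x (by omega) (by omega) hxn with h' | h'
    · omega
    · have := h' m (by omega) (by omega)
      omega

lemma irred_C {n r : ℕ} {α f g : ℕ → ℕ} (hr : 3 ≤ r) (hrn : r + 1 ≤ n) (hα : α ∈ Cset n r)
    (hf : f ∈ ORDr n r) (hg : g ∈ ORDr n r) (h : comp f g = α) : f = α ∨ g = α := by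
  have hn : 1 ≤ n := by omega
  obtain ⟨fd, fo, fc⟩ := (mem_ORDr hn).1 hf
  obtain ⟨gd, go, gc⟩ := (mem_ORDr hn).1 hg
  have hv : ∀ x, g (f x) = α x := fun x => congrFun h x
  rcases hα with ⟨h1, h2, h3, -, -⟩ | ⟨m, hm2, hmr, rfl⟩
  · left
    have hfix : ∀ v ∈ im n α, f v = v ∧ g v = v := by
      intro v hvm
      obtain ⟨x, a, b, rfl⟩ := mem_im.1 hvm
      have p := h1.1.1.1 x a b
      refine fix_of_comp fd gd p.1 p.2 ?_
      rw [hv]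
      exact congrFun h2 x
    have hsub : im n α ⊆ im n f := by
      intro v hvm
      obtain ⟨x, a, b, e⟩ := mem_im.1 hvm
      have p := h1.1.1.1 x a b
      exact mem_im.2 ⟨v, by omega, by omega, (hfix v hvm).1⟩
    have heq : im n α = im n f := Finset.eq_of_subset_of_card_le hsub (by omega)
    funext x
    by_cases hx : 1 ≤ x ∧ x ≤ n
    · have hmem : f x ∈ im n α := by rw [heq]; exact mem_im.2 ⟨x, hx.1, hx.2, rfl⟩
      rw [← hv x, (hfix _ hmem).2]
    · rw [fd.1.2 x hx, h1.1.1.2 x hx]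
  · have hmn : m + 1 ≤ n := by omega
    have hfix : ∀ x, 1 ≤ x → x ≤ m → f x = x ∧ g x = x := by
      intro x a b
      refine fix_of_comp fd gd a (by omega) ?_
      rw [hv]
      simp [rho, b]
    have htail : ∀ x, m < x → x ≤ n → g (f x) = 1 := by
      intro x a b
      rw [hv]
      simp only [rho]
      rw [if_neg (by omega), if_neg (by omega)]
    have fm := hfix m (by omega) le_rfl
    have f2 := hfix 2 (by omega) hm2
    by_cases hf1 : f (m + 1) = 1
    · left
      exact rho_of_next hm2 hmn fd fo (fun x a b => (hfix x a b).1) hf1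
    · right
      have p := fd.1.1 (m+1) (by omega) hmn
      have q := fd.2 (m+1) (by omega) hmn
      have ht := htail (m+1) (by omega) hmn
      have hgt : m < f (m+1) := by
        by_contra hcon
        have := (hfix (f (m+1)) p.1 (by omega)).2
        omega
      refine rho_of_next hm2 hmn gd go (fun x a b => (hfix x a b).2) ?_
      rw [show m + 1 = f (m + 1) by omega]
      exact ht

lemma gen_sub {n r : ℕ} {S : Set (ℕ → ℕ)} (hS : IsSubsemigroupOf S (ORDr n r)) {A : Set (ℕ → ℕ)}
    (hA : A ⊆ S) {f : ℕ → ℕ} (hf : gen A f) : f ∈ S := by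
  induction hf with
  | base h => exact hA h
  | mul _ _ ih1 ih2 => exact hS.2 _ ih1 _ ih2

lemma full_of_meets {n r : ℕ} (hr : 3 ≤ r) (hrn : r + 1 ≤ n) {S : Set (ℕ → ℕ)}
    (hS : IsSubsemigroupOf S (ORDr n r)) (hC : Cset n r ⊆ S)
    (hL : ∀ m, 3 ≤ m → m + 1 ≤ n → ∃ g ∈ Lset n (rhat n r) m, g ∈ S) : S = ORDr n r := by
  have hn : 1 ≤ n := by omega
  have hP : ∀ f, f ∈ Dn n → Pres n f → (im n f).card ≤ r → f ∈ S :=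
    fun f a b c => gen_sub hS hC (gen_pres hr hrn a b c)
  refine Set.Subset.antisymm hS.1 ?_
  intro f hf
  obtain ⟨fd, fo, fc⟩ := (mem_ORDr hn).1 hf
  by_cases hp : Pres n f
  · exact hP f fd hp fc
  · obtain ⟨m, h, g, hm, hmn, ⟨a1, a2, a3⟩, ⟨b1, b2, b3⟩, e⟩ :=
      rev_factor hr hrn fd (fo.resolve_left hp) hp fc
    have hlam : lam n (rhat n r) m ∈ S := by
      obtain ⟨k, hk, hkS⟩ := hL m hm hmn
      have hlL : lam n (rhat n r) m ∈ Lset n (rhat n r) m :=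
        (mem_Lset hr hrn hm hmn).2 ⟨lam_mem hr hrn hm hmn, Q_lam hr hrn hm hmn⟩
      obtain ⟨u, u1, u2, u3, e⟩ := L_trans hr hrn hm hmn hlL hk
      rw [e]
      exact hS.2 _ (hP u u1 u2 u3) _ hkS
    rw [e]
    exact hS.2 _ (hP h a1 a2 a3) _ (hS.2 _ hlam _ (hP g b1 b2 b3))

lemma C_sub {n r : ℕ} (hr : 3 ≤ r) (hrn : r + 1 ≤ n) : Cset n r ⊆ ORDr n r := by
  intro f hf
  obtain ⟨a, b, c⟩ := C_props hr hrn hf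
  exact (mem_ORDr (by omega)).2 ⟨a, Or.inl b, c⟩

lemma sub_C {n r : ℕ} (hr : 3 ≤ r) (hrn : r + 1 ≤ n) {α : ℕ → ℕ} (hα : α ∈ Cset n r) :
    IsSubsemigroupOf (ORDr n r \ {α}) (ORDr n r) := by
  refine ⟨Set.diff_subset, ?_⟩
  rintro f ⟨hf, hf'⟩ g ⟨hg, hg'⟩
  refine ⟨comp_ORDr (by omega) hf hg, fun h => ?_⟩
  rcases irred_C hr hrn hα hf hg h with h | h
  · exact hf' h
  · exact hg' h

lemma sub_L {n r m : ℕ} (hr : 3 ≤ r) (hrn : r + 1 ≤ n) (hm : 3 ≤ m) (hmn : m + 1 ≤ n) :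
    IsSubsemigroupOf (ORDr n r \ Lset n (rhat n r) m) (ORDr n r) := by
  refine ⟨Set.diff_subset, ?_⟩
  rintro f ⟨hf, hf'⟩ g ⟨hg, hg'⟩
  refine ⟨comp_ORDr (by omega) hf hg, fun h => ?_⟩
  rcases irred_L hr hrn hm hmn hf hg h with h | h
  · exact hf' h
  · exact hg' h

lemma max_C {n r : ℕ} (hr : 3 ≤ r) (hrn : r + 1 ≤ n) {α : ℕ → ℕ} (hα : α ∈ Cset n r) :
    IsMaximalSubsemigroupOf (ORDr n r \ {α}) (ORDr n r) := by
  have hm := C_sub hr hrn hα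
  refine ⟨sub_C hr hrn hα, ?_, ?_⟩
  · intro h
    rw [← h] at hm
    exact hm.2 rfl
  · intro U hU hsub
    by_cases hαU : α ∈ U
    · right
      refine Set.Subset.antisymm hU.1 fun f hf => ?_
      by_cases e : f = α
      · rw [e]; exact hαU
      · exact hsub ⟨hf, e⟩
    · left
      refine Set.Subset.antisymm (fun f hf => ⟨hU.1 hf, ?_⟩) hsub
      rintro rfl
      exact hαU hf

lemma max_L {n r m : ℕ} (hr : 3 ≤ r) (hrn : r + 1 ≤ n) (hm : 3 ≤ m) (hmn : m + 1 ≤ n) :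
    IsMaximalSubsemigroupOf (ORDr n r \ Lset n (rhat n r) m) (ORDr n r) := by
  have hl := lam_mem hr hrn hm hmn
  have hlL : lam n (rhat n r) m ∈ Lset n (rhat n r) m :=
    (mem_Lset hr hrn hm hmn).2 ⟨hl, Q_lam hr hrn hm hmn⟩
  refine ⟨sub_L hr hrn hm hmn, ?_, ?_⟩
  · intro h
    rw [← h] at hl
    exact hl.2 hlL
  · intro U hU hsub
    by_cases hex : ∃ g ∈ Lset n (rhat n r) m, g ∈ U
    · right
      obtain ⟨g, hg, hgU⟩ := hex
      refine Set.Subset.antisymm hU.1 fun f hf => ?_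
      by_cases e : f ∈ Lset n (rhat n r) m
      · obtain ⟨u, u1, u2, u3, e⟩ := L_trans hr hrn hm hmn e hg
        rw [e]
        refine hU.2 _ (hsub ⟨(mem_ORDr (by omega)).2 ⟨u1, Or.inl u2, u3⟩, fun hu => ?_⟩) _ hgU
        exact Q_rev hr hrn hm hmn ((mem_Lset hr hrn hm hmn).1 hu).2 u2
      · exact hsub ⟨hf, e⟩
    · left
      exact Set.Subset.antisymm (fun f hf => ⟨hU.1 hf, fun h => hex ⟨f, h, hf⟩⟩) hsub

theorem maximal_subsemigroups_classification (n r : ℕ) (hn : 4 ≤ n) (hr : 3 ≤ r) (hrn : r ≤ n - 1)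
    (S : Set (ℕ → ℕ)) (hS : IsSubsemigroupOf S (ORDr n r)) :
    IsMaximalSubsemigroupOf S (ORDr n r) ↔
    ((∃ α ∈ Cset n r, S = ORDr n r \ {α}) ∨
     (∃ m, n - rhat n r + 2 ≤ m ∧ m ≤ n - 1 ∧ S = ORDr n r \ {lam n (rhat n r) m}) ∨
     (∃ m, 3 ≤ m ∧ m ≤ n - rhat n r + 1 ∧ S = ORDr n r \ Lset n (rhat n r) m)) := by
  have hrn' : r + 1 ≤ n := by omega
  have hrh := rhat_spec n r
  have hn1 : 1 ≤ n := by omega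
  constructor
  · intro hmax
    have final : ∀ P : Set (ℕ → ℕ), IsMaximalSubsemigroupOf (ORDr n r \ P) (ORDr n r) →
        (∀ g ∈ P, g ∉ S) → S = ORDr n r \ P := by
      intro P hP hSP
      rcases hmax.2.2 _ hP.1 (fun f hf => ⟨hS.1 hf, fun h => hSP f h hf⟩) with h | h
      · exact h.symm
      · exact absurd h hP.2.1
    by_cases hC : Cset n r ⊆ S
    · by_cases hL : ∀ m, 3 ≤ m → m + 1 ≤ n → ∃ g ∈ Lset n (rhat n r) m, g ∈ S
      · exact absurd (full_of_meets hr hrn' hS hC hL) hmax.2.1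
      · push Not at hL
        obtain ⟨m, hm, hmn, hmL⟩ := hL
        have e := final _ (max_L hr hrn' hm hmn) hmL
        right
        by_cases hcase : n - rhat n r + 2 ≤ m
        · left
          refine ⟨m, hcase, by omega, ?_⟩
          rw [← Lset_single hr hrn' hcase hmn]
          exact e
        · right
          exact ⟨m, hm, by omega, e⟩
    · left
      obtain ⟨α, hα, hαS⟩ := Set.not_subset.1 hC
      refine ⟨α, hα, final _ (max_C hr hrn' hα) ?_⟩
      rintro g rfl
      exact hαS
  · rintro (⟨α, hα, rfl⟩ | ⟨m, h1, h2, rfl⟩ | ⟨m, h1, h2, rfl⟩)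
    · exact max_C hr hrn' hα
    · rw [← Lset_single hr hrn' h1 (by omega)]
      exact max_L hr hrn' (by omega) (by omega)
    · exact max_L hr hrn' h1 (by omega)

end ORDPaper
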